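/- arXiv:math/0501001 — 5 statements merged into one kernel-verified Lean document; each statement's English description precedes it below -/
import Mathlib

section
/- Let X and Λ be topological spaces and f : X × Λ → ℝ a function such that for each x ∈ X the set {λ ∈ Λ : f(x, λ) ≥ 0} is closed in Λ. For each λ ∈ Λ put F(λ) = {x ∈ X : f(x, λ) ≤ 0}. Assume the multifunction F : Λ → 2^X is not lower semicontinuous at some λ₀ ∈ Λ. Then every point x₀ ∈ NLS(F(λ₀)) is a local minimum of the function x ↦ f(x, λ₀) and satisfies f(x₀, λ₀) = 0. -/
/-- **Proposition 1.** Let `X, Λ` be topological spaces and `f : X × Λ → ℝ` such that for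
each `x ∈ X` the set `{λ : f(x,λ) ≥ 0}` is closed. For `λ ∈ Λ` put
`F(λ) = {x : f(x,λ) ≤ 0}`. Assume `F` is not lower semicontinuous at `λ₀ ∈ Λ`.
Then every `x₀ ∈ NLS(F(λ₀))` (i.e. `x₀ ∈ F(λ₀)` having a neighbourhood `Ω` with `λ₀` in the
closure of `Λ \ F⁻(Ω)`) is a local minimum of `f(·,λ₀)` with `f(x₀,λ₀) = 0`. -/
theorem ricceri_prop1 {X Λ : Type*} [TopologicalSpace X] [TopologicalSpace Λ]
    (f : X → Λ → ℝ)
    (hclosed : ∀ x : X, IsClosed {l : Λ | 0 ≤ f x l})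
    (F : Λ → Set X) (hF : ∀ l : Λ, F l = {x : X | f x l ≤ 0})
    (l₀ : Λ)
    (hnotlsc : ¬ ∀ Ω : Set X, IsOpen Ω → (F l₀ ∩ Ω).Nonempty →
      l₀ ∈ interior {l : Λ | (F l ∩ Ω).Nonempty})
    (x₀ : X)
    (hx₀ : x₀ ∈ F l₀ ∧ ∃ Ω ∈ nhds x₀, l₀ ∈ closure {l : Λ | ¬ (F l ∩ Ω).Nonempty}) :
    (∃ U ∈ nhds x₀, ∀ x ∈ U, f x₀ l₀ ≤ f x l₀) ∧ f x₀ l₀ = 0 := by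
  obtain ⟨hx, Ω, hΩ, hcl⟩ := hx₀
  have key : ∀ x ∈ Ω, 0 ≤ f x l₀ := by
    intro x hxΩ
    have hsub : {l : Λ | ¬ (F l ∩ Ω).Nonempty} ⊆ {l : Λ | 0 ≤ f x l} := by
      intro l hl
      by_contra hneg
      apply hl
      refine ⟨x, ?_, hxΩ⟩
      rw [hF]
      have hneg2 : ¬ (0 ≤ f x l) := hneg
      have hlt : f x l ≤ 0 := (not_le.mp hneg2).le
      exact hlt
    exact closure_minimal hsub (hclosed x) hcl
  rw [hF] at hx
  have h0 : f x₀ l₀ = 0 := le_antisymm hx (key x₀ (mem_of_mem_nhds hΩ))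
  refine ⟨⟨Ω, hΩ, fun x hxΩ => ?_⟩, h0⟩
  rw [h0]
  exact key x hxΩ
end

section
/- Let (X, τ) be a topological space, τ₁ a topology on X weaker than τ_s, I ⊆ ℝ an interval, and F : I → 2^X a multifunction with τ₁-closed values such that for each x ∈ X the set I \ F⁻(x) = {λ ∈ I : x ∉ F(λ)} is a non-empty subinterval of I that is open in I. Suppose there is λ₀ ∈ I such that F(λ₀) is non-empty and sequentially τ-compact. Then there exists λ* ∈ I such that F is not τ₁-lower semicontinuous at λ*, and moreover NLS_{τ₁}(F(λ*)) ∩ F(λ₀) ≠ ∅. -/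
/-- Every nonempty set of reals has a cofinal sequence. -/
theorem ricceri_real_cofinal (S : Set ℝ) (hS : S.Nonempty) :
    ∃ u : ℕ → ℝ, (∀ n, u n ∈ S) ∧ ∀ s ∈ S, ∃ N, ∀ n ≥ N, s ≤ u n := by
  by_cases hb : BddAbove S
  · by_cases hm : sSup S ∈ S
    · exact ⟨fun _ => sSup S, fun _ => hm, fun s hs => ⟨0, fun _ _ => le_csSup hb hs⟩⟩
    · obtain ⟨u, hu, hlim, hmem⟩ := exists_seq_tendsto_sSup hS hb
      refine ⟨u, hmem, fun s hs => ?_⟩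
      have hlt : s < sSup S := lt_of_le_of_ne (le_csSup hb hs) (fun h => hm (h ▸ hs))
      obtain ⟨N, hN⟩ := Filter.eventually_atTop.1 (hlim.eventually (lt_mem_nhds hlt))
      exact ⟨N, fun n hn => (hN n hn).le⟩
  · rw [not_bddAbove_iff] at hb
    choose u hu1 hu2 using fun n : ℕ => hb n
    refine ⟨u, hu1, fun s _ => ?_⟩
    obtain ⟨N, hN⟩ := exists_nat_ge s
    refine ⟨N, fun n hn => ?_⟩
    have : (N : ℝ) ≤ n := by exact_mod_cast hn
    linarith [hu2 n]

theorem ricceri_aux {X ι : Type*} [LinearOrder ι] [TopologicalSpace ι] [OrderTopology ι]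
    [DenselyOrdered ι] (φ : ι → ℝ) (hφ : StrictMono φ)
    (hinf : ∀ S : Set ι, S.Nonempty → BddBelow S → ∃ a, IsGLB S a)
    (τ τ₁ : TopologicalSpace X)
    (hweak : ∀ A : Set X, @IsOpen X τ₁ A → @IsSeqClosed X τ Aᶜ)
    (F : ι → Set X)
    (hvals : ∀ l, @IsClosed X τ₁ (F l))
    (hne : ∀ x : X, {l | x ∉ F l}.Nonempty)
    (hconn : ∀ x : X, {l | x ∉ F l}.OrdConnected)
    (hopen : ∀ x : X, IsOpen {l | x ∉ F l})
    (l₀ : ι) (hcomp : @IsSeqCompact X τ (F l₀))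
    (x₀ : X) (hx₀ : ∀ l ≤ l₀, x₀ ∈ F l) :
    ∃ a : ι, ({s ∈ F a | ∃ Ω ∈ @nhds X τ₁ s,
          a ∈ closure {l | ¬ (F l ∩ Ω).Nonempty}} ∩ F l₀).Nonempty := by
  have hseqcl : ∀ l, @IsSeqClosed X τ (F l) := by
    intro l
    have := hweak (F l)ᶜ (@IsClosed.isOpen_compl X τ₁ _ (hvals l))
    rwa [compl_compl] at this
  let S : Set ι := {m | l₀ ≤ m ∧ ∃ y, ∀ n ≤ m, y ∈ F n}
  have hl₀S : l₀ ∈ S := ⟨le_rfl, x₀, hx₀⟩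
  obtain ⟨v, hvS, hv⟩ := ricceri_real_cofinal (φ '' S) ⟨_, l₀, hl₀S, rfl⟩
  choose u huS huv using hvS
  have hu : ∀ s ∈ S, ∃ N, ∀ n ≥ N, s ≤ u n := by
    intro s hs
    obtain ⟨N, hN⟩ := hv (φ s) ⟨s, hs, rfl⟩
    refine ⟨N, fun n hn => ?_⟩
    have := hN n hn
    rw [← huv n] at this
    exact hφ.le_iff_le.1 this
  choose w hw using fun n => (huS n).2
  obtain ⟨y, hy, g, hg, hlim⟩ := hcomp (fun n => hw n l₀ (huS n).1)
  have hyS : ∀ m ∈ S, ∀ n ≤ m, y ∈ F n := by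
    intro m hm n hn
    obtain ⟨N, hN⟩ := hu m hm
    have h1 : ∀ k, w (g (k + N)) ∈ F n := fun k =>
      hw _ _ (hn.trans (hN _ ((Nat.le_add_left N k).trans (hg.id_le _))))
    exact hseqcl n h1 ((Filter.tendsto_add_atTop_iff_nat N).2 hlim)
  have hlb : ∀ l, y ∉ F l → l₀ < l := fun l hl =>
    not_le.1 fun h => hl (hyS l₀ hl₀S l h)
  obtain ⟨a, ha⟩ := hinf _ (hne y) ⟨l₀, fun l hl => (hlb l hl).le⟩
  have hl₀a : l₀ ≤ a := ha.2 fun l hl => (hlb l hl).le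
  have hya : y ∈ F a := by
    by_contra hcon
    obtain ⟨l, hl, hsub⟩ := exists_Ioc_subset_of_mem_nhds
      ((hopen y).mem_nhds hcon) ⟨l₀, hlb a hcon⟩
    obtain ⟨c, hc1, hc2⟩ := exists_between hl
    exact absurd (ha.1 (hsub ⟨hc1, hc2.le⟩)) (not_le.2 hc2)
  obtain ⟨b, hb⟩ := hne y
  have hab : a < b := lt_of_le_of_ne (ha.1 hb) (fun h => hb (h ▸ hya))
  refine ⟨a, y, ⟨hya, (F b)ᶜ, ?_, ?_⟩, hy⟩
  · exact @IsOpen.mem_nhds X τ₁ _ _ (@IsClosed.isOpen_compl X τ₁ _ (hvals b)) hb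
  · have hsub : Set.Ioo a b ⊆ {l | ¬ (F l ∩ (F b)ᶜ).Nonempty} := by
      rintro m ⟨ham, hmb⟩ ⟨z, hzm, hzb⟩
      have hmS : m ∈ S := by
        refine ⟨hl₀a.trans ham.le, z, fun n hn => ?_⟩
        by_contra hzn
        exact (hconn z).out hzn hzb ⟨hn, hmb.le⟩ hzm
      have : m ≤ a := ha.2 fun l hl => not_lt.1 fun h => hl (hyS m hmS l h.le)
      exact absurd this (not_le.2 ham)
    apply closure_mono hsub
    rw [closure_Ioo hab.ne]
    exact ⟨le_rfl, hab.le⟩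

/-- **Theorem 2.** Let `(X, τ)` be a topological space, `τ₁` a topology weaker than `τ_s`
(the complement of every `τ₁`-open set is sequentially `τ`-closed), `I` a real interval,
and `F : I → 2^X` a multifunction with `τ₁`-closed values such that for each `x ∈ X` the set
`I \ F⁻(x) = {λ ∈ I : x ∉ F(λ)}` is a non-empty subinterval of `I` open in `I`. Suppose
there is `λ₀ ∈ I` with `F(λ₀)` non-empty and sequentially `τ`-compact. Then `F` is not
`τ₁`-lower semicontinuous at some `λ* ∈ I` with `NLS_{τ₁}(F(λ*)) ∩ F(λ₀) ≠ ∅`. -/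
theorem ricceri_thm2 {X : Type*} (τ τ₁ : TopologicalSpace X)
    (hweak : ∀ A : Set X, @IsOpen X τ₁ A → @IsSeqClosed X τ Aᶜ)
    (I : Set ℝ) (hI : I.OrdConnected)
    (F : I → Set X)
    (hvals : ∀ l : I, @IsClosed X τ₁ (F l))
    (hne : ∀ x : X, {l : I | x ∉ F l}.Nonempty)
    (hconn : ∀ x : X, {l : I | x ∉ F l}.OrdConnected)
    (hopen : ∀ x : X, IsOpen {l : I | x ∉ F l})
    (l₀ : I) (hFl₀ : (F l₀).Nonempty) (hcomp : @IsSeqCompact X τ (F l₀)) :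
    ∃ lstar : I,
      (¬ ∀ Ω : Set X, @IsOpen X τ₁ Ω → (F lstar ∩ Ω).Nonempty →
        lstar ∈ interior {l : I | (F l ∩ Ω).Nonempty}) ∧
      ({s ∈ F lstar | ∃ Ω ∈ @nhds X τ₁ s,
          (lstar : I) ∈ closure {l : I | ¬ (F l ∩ Ω).Nonempty}} ∩ F l₀).Nonempty := by
  have key : ∃ a : I, ({s ∈ F a | ∃ Ω ∈ @nhds X τ₁ s,
          (a : I) ∈ closure {l : I | ¬ (F l ∩ Ω).Nonempty}} ∩ F l₀).Nonempty := by
    haveI := hI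
    haveI : Inhabited I := ⟨l₀⟩
    obtain ⟨x, hx⟩ := hFl₀
    by_cases h : ∀ l ≤ l₀, x ∈ F l
    · exact ricceri_aux (fun i : I => (i : ℝ)) (fun _ _ h => h)
        (fun S h1 h2 => ⟨sInf S, isGLB_csInf h1 h2⟩) τ τ₁ hweak F hvals hne hconn hopen
        l₀ hcomp x h
    · push Not at h
      obtain ⟨c, hc, hxc⟩ := h
      have h' : ∀ l ≥ l₀, x ∈ F l := by
        intro l hl
        by_contra hxl
        exact (hconn x).out hxc hxl ⟨hc, hl⟩ hx
      exact ricceri_aux (ι := Iᵒᵈ) (fun i => -((OrderDual.ofDual i : I) : ℝ))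
        (fun _ _ h => neg_lt_neg (show ((_ : I) : ℝ) < _ from h))
        (fun S h1 h2 => ⟨sInf S, isGLB_csInf h1 h2⟩) τ τ₁ hweak
        (fun i => F (OrderDual.ofDual i)) (fun l => hvals _) hne
        (fun z => (hconn z).dual) hopen
        (OrderDual.toDual l₀) hcomp x (fun l hl => h' _ hl)
  obtain ⟨a, s, ⟨hsa, Ω, hΩ, hcl⟩, hs⟩ := key
  refine ⟨a, fun hlsc => ?_, s, ⟨hsa, Ω, hΩ, hcl⟩, hs⟩
  obtain ⟨U, hUΩ, hU, hsU⟩ := (@mem_nhds_iff X τ₁ _ _).1 hΩ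
  have h1 := hlsc U hU ⟨s, hsa, hsU⟩
  obtain ⟨l, hl1, hl2⟩ := mem_closure_iff.1 hcl _ isOpen_interior h1
  have h2 : l ∈ {l : I | (F l ∩ U).Nonempty} := interior_subset hl1
  exact hl2 (Set.Nonempty.mono
    (Set.inter_subset_inter_right _ hUΩ) h2)
end

section
/- Let (X, τ) be a topological space, τ₁ a topology on X weaker than τ_s, I ⊆ ℝ an interval, and f : X × I → ℝ a function satisfying: (d₁) for each x ∈ X, the set {λ ∈ I : f(x, λ) ≥ 0} is closed in I and the set {λ ∈ I : f(x, λ) > 0} is a non-empty subinterval of I that is open in I; (d₂) for each λ ∈ I, the set {x ∈ X : f(x, λ) ≤ 0} is τ₁-closed; (d₃) there is λ₀ ∈ I such that the set {x ∈ X : f(x, λ₀) ≤ 0} is non-empty and sequentially τ-compact. Then there exist λ* ∈ I and a point x* ∈ X such that x* is a τ₁-local minimum of the function x ↦ f(x, λ*), f(x*, λ*) = 0, and f(x*, λ₀) ≤ 0. -/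
theorem ricceri_aux_s4 {X : Type*} (τ τ₁ : TopologicalSpace X)
    (hweak : ∀ A : Set X, @IsOpen X τ₁ A → @IsSeqClosed X τ Aᶜ)
    (I : Set ℝ) (hI : I.OrdConnected)
    (f : X → ℝ → ℝ)
    (d1closed : ∀ x : X, IsClosed {l : I | 0 ≤ f x l})
    (d1ne' : ∀ x : X, ∃ m ∈ I, 0 < f x m)
    (d1conn : ∀ x : X, ∀ a ∈ I, ∀ c ∈ I, ∀ b, a ≤ b → b ≤ c → 0 < f x a → 0 < f x c → 0 < f x b)
    (d1open : ∀ x : X, IsOpen {l : I | 0 < f x l})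
    (d2 : ∀ l ∈ I, @IsClosed X τ₁ {x : X | f x l ≤ 0})
    (l₀ : ℝ) (hl₀ : l₀ ∈ I)
    (d3comp : @IsSeqCompact X τ {x : X | f x l₀ ≤ 0})
    (hne : ∃ x, f x l₀ ≤ 0 ∧ ∃ m ∈ I, l₀ < m ∧ 0 < f x m) :
    ∃ lstar ∈ I, ∃ xstar : X,
      (∃ U ∈ @nhds X τ₁ xstar, ∀ x ∈ U, f xstar lstar ≤ f x lstar) ∧
      f xstar lstar = 0 ∧ f xstar l₀ ≤ 0 := by
  classical
  set K : Set X := {x | f x l₀ ≤ 0 ∧ ∃ m ∈ I, l₀ < m ∧ 0 < f x m} with hK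
  have key : ∀ x ∈ K, ∃ a ∈ I, l₀ ≤ a ∧ IsGLB {l | l ∈ I ∧ 0 < f x l} a ∧ f x a = 0 := by
    rintro x ⟨hx0, m, hmI, hlm, hm⟩
    have hlb : l₀ ∈ lowerBounds {l | l ∈ I ∧ 0 < f x l} := by
      rintro l ⟨hl, hfl⟩
      by_contra! h
      exact absurd (d1conn x l hl m hmI l₀ h.le hlm.le hfl hm) (not_lt.2 hx0)
    have hnon : {l | l ∈ I ∧ 0 < f x l}.Nonempty := ⟨m, hmI, hm⟩
    have hg : IsGLB {l | l ∈ I ∧ 0 < f x l} (sInf {l | l ∈ I ∧ 0 < f x l}) :=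
      isGLB_csInf hnon ⟨l₀, hlb⟩
    generalize sInf {l | l ∈ I ∧ 0 < f x l} = a at hg
    have hla : l₀ ≤ a := hg.2 hlb
    have haI : a ∈ I := hI.out hl₀ hmI ⟨hla, hg.1 ⟨hmI, hm⟩⟩
    refine ⟨a, haI, hla, hg, le_antisymm ?_ ?_⟩
    · by_contra! hpos
      have hlt : l₀ < a := lt_of_le_of_ne hla (by rintro rfl; linarith)
      obtain ⟨O, hO, hOe⟩ := isOpen_induced_iff.1 (d1open x)
      have haO : a ∈ O := by
        have : (⟨a, haI⟩ : I) ∈ Subtype.val ⁻¹' O := by rw [hOe]; exact hpos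
        exact this
      obtain ⟨l, hl, hsub⟩ := exists_Ioc_subset_of_mem_nhds (hO.mem_nhds haO) ⟨l₀, hlt⟩
      obtain ⟨b, hb1, hb2⟩ := exists_between (max_lt hl hlt)
      have hbI : b ∈ I := hI.out hl₀ haI ⟨(le_max_right _ _).trans hb1.le, hb2.le⟩
      have hbO : (⟨b, hbI⟩ : I) ∈ Subtype.val ⁻¹' O :=
        hsub ⟨(le_max_left _ _).trans_lt hb1, hb2.le⟩
      rw [hOe] at hbO
      exact absurd (hg.1 ⟨hbI, hbO⟩) (not_le.2 hb2)
    · obtain ⟨C, hC, hCe⟩ := isClosed_induced_iff.1 (d1closed x)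
      have hsub : {l | l ∈ I ∧ 0 < f x l} ⊆ C := by
        rintro l ⟨hl, hfl⟩
        have : (⟨l, hl⟩ : I) ∈ Subtype.val ⁻¹' C := by rw [hCe]; exact hfl.le
        exact this
      have haC : a ∈ C := closure_minimal hsub hC (hg.mem_closure hnon)
      have : (⟨a, haI⟩ : I) ∈ Subtype.val ⁻¹' C := haC
      rw [hCe] at this
      exact this
  choose! a haI hla hg hfa using key
  -- the infimum map attains its maximum on K
  have hmax : ∃ y ∈ K, ∀ z ∈ K, a z ≤ a y := by
    obtain ⟨x0, hx0⟩ := hne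
    obtain ⟨u, -, hu, huA⟩ := exists_seq_tendsto_sSup
      (S := (fun x => (a x : EReal)) '' K) ⟨_, x0, hx0, rfl⟩ (OrderTop.bddAbove _)
    choose x hxK hxu using huA
    obtain ⟨y, hy0, φ, hφ, hlim⟩ := d3comp (fun n => (hxK n).1)
    have hcl : ∀ m ∈ I, (∀ᶠ n in Filter.atTop, f (x n) m ≤ 0) → f y m ≤ 0 := by
      intro m hm hev
      obtain ⟨N, hN⟩ := Filter.eventually_atTop.1 (hφ.tendsto_atTop.eventually hev)
      have hsc := hweak _ (d2 m hm).isOpen_compl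
      rw [compl_compl] at hsc
      exact hsc (x := fun n => x (φ (n + N))) (fun n => hN _ (Nat.le_add_left _ _))
        (hlim.comp (Filter.tendsto_add_atTop_nat N))
    have hle : ∀ z ∈ K, ∀ m ∈ I, m ≤ a z → f z m ≤ 0 := by
      intro z hz m hm hmz
      by_contra! h
      have h2 := (hg z hz).1 ⟨hm, h⟩
      have : m = a z := le_antisymm hmz h2
      rw [this, hfa z hz] at h
      exact lt_irrefl _ h
    obtain ⟨m, hmI, hm⟩ : ∃ m ∈ I, 0 < f y m := d1ne' y
    have hyK : y ∈ K := by
      refine ⟨hy0, m, hmI, ?_, hm⟩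
      by_contra! h
      refine absurd (hcl m hmI (Filter.Eventually.of_forall fun n => ?_)) (not_le.2 hm)
      exact hle _ (hxK n) m hmI (h.trans (hla _ (hxK n)))
    refine ⟨y, hyK, fun z hz => ?_⟩
    by_contra! h
    obtain ⟨m, ⟨hmI, hm⟩, -, hmz⟩ := (hg y hyK).exists_between h
    refine absurd (hcl m hmI ?_) (not_le.2 hm)
    have hs : (m : EReal) < sSup ((fun x => (a x : EReal)) '' K) :=
      (EReal.coe_lt_coe_iff.2 hmz).trans_le (le_sSup ⟨z, hz, rfl⟩)
    filter_upwards [hu.eventually (lt_mem_nhds hs)] with n hn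
    refine hle _ (hxK n) m hmI ?_
    rw [← hxu n] at hn
    exact (EReal.coe_lt_coe_iff.1 hn).le
  obtain ⟨y, hyK, hymax⟩ := hmax
  obtain ⟨m, hmI, hlm, hm⟩ := hyK.2
  have ham : a y ≤ m := (hg y hyK).1 ⟨hmI, hm⟩
  refine ⟨a y, haI y hyK, y, ⟨{x | f x m ≤ 0}ᶜ, ?_, ?_⟩, hfa y hyK, hyK.1⟩
  · exact (d2 m hmI).isOpen_compl.mem_nhds (not_le.2 hm)
  · intro x hx
    have hx : 0 < f x m := not_le.1 hx
    rw [hfa y hyK]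
    by_cases hx0 : f x l₀ ≤ 0
    · have hxK : x ∈ K := ⟨hx0, m, hmI, hlm, hx⟩
      rcases (hymax x hxK).lt_or_eq with h | h
      · obtain ⟨c, ⟨hcI, hc⟩, -, hcy⟩ := (hg x hxK).exists_between h
        exact (d1conn x c hcI m hmI _ hcy.le ham hc hx).le
      · rw [← h, hfa x hxK]
    · exact (d1conn x l₀ hl₀ m hmI _ (hla y hyK) ham (not_le.1 hx0) hx).le


/-- **Theorem 3.** Let `(X, τ)` be a topological space, `τ₁` a topology weaker than `τ_s`
(the complement of every `τ₁`-open set is sequentially `τ`-closed), `I` a real interval,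
and `f : X × I → ℝ` such that:
(d₁) for each `x ∈ X`, `{λ ∈ I : f(x,λ) ≥ 0}` is closed in `I` and `{λ ∈ I : f(x,λ) > 0}`
is a non-empty subinterval of `I` open in `I`;
(d₂) for each `λ ∈ I`, `{x : f(x,λ) ≤ 0}` is `τ₁`-closed;
(d₃) there is `λ₀ ∈ I` such that `{x : f(x,λ₀) ≤ 0}` is non-empty and sequentially
`τ`-compact.
Then there exist `λ* ∈ I` and `x* ∈ X` such that `x*` is a `τ₁`-local minimum of
`f(·,λ*)`, `f(x*,λ*) = 0` and `f(x*,λ₀) ≤ 0`. -/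
theorem ricceri_thm3 {X : Type*} (τ τ₁ : TopologicalSpace X)
    (hweak : ∀ A : Set X, @IsOpen X τ₁ A → @IsSeqClosed X τ Aᶜ)
    (I : Set ℝ) (hI : I.OrdConnected)
    (f : X → ℝ → ℝ)
    (d1closed : ∀ x : X, IsClosed {l : I | 0 ≤ f x l})
    (d1ne : ∀ x : X, {l : I | 0 < f x l}.Nonempty)
    (d1conn : ∀ x : X, {l : I | 0 < f x l}.OrdConnected)
    (d1open : ∀ x : X, IsOpen {l : I | 0 < f x l})
    (d2 : ∀ l ∈ I, @IsClosed X τ₁ {x : X | f x l ≤ 0})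
    (l₀ : ℝ) (hl₀ : l₀ ∈ I)
    (d3ne : {x : X | f x l₀ ≤ 0}.Nonempty)
    (d3comp : @IsSeqCompact X τ {x : X | f x l₀ ≤ 0}) :
    ∃ lstar ∈ I, ∃ xstar : X,
      (∃ U ∈ @nhds X τ₁ xstar, ∀ x ∈ U, f xstar lstar ≤ f x lstar) ∧
      f xstar lstar = 0 ∧ f xstar l₀ ≤ 0 := by
  have hne' : ∀ x : X, ∃ m ∈ I, 0 < f x m := fun x => by
    obtain ⟨⟨m, hm⟩, h⟩ := d1ne x
    exact ⟨m, hm, h⟩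
  have hconn : ∀ x : X, ∀ a ∈ I, ∀ c ∈ I, ∀ b, a ≤ b → b ≤ c → 0 < f x a → 0 < f x c →
      0 < f x b := by
    intro x a ha c hc b hab hbc hfa hfc
    exact (d1conn x).out (x := ⟨a, ha⟩) hfa (y := ⟨c, hc⟩) hfc
      (show (⟨b, hI.out ha hc ⟨hab, hbc⟩⟩ : I) ∈ _ from ⟨hab, hbc⟩)
  obtain ⟨x, hx⟩ := d3ne
  obtain ⟨m, hmI, hm⟩ := hne' x
  rcases lt_trichotomy l₀ m with h | h | h
  · exact ricceri_aux_s4 τ τ₁ hweak I hI f d1closed hne' hconn d1open d2 l₀ hl₀ d3comp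
      ⟨x, hx, m, hmI, h, hm⟩
  · subst h
    exact absurd hm (not_lt.2 hx)
  · let J : Set ℝ := {l | -l ∈ I}
    let g : J → I := fun l => ⟨-l.1, l.2⟩
    have hgc : Continuous g := by
      refine Continuous.subtype_mk ?_ _
      exact continuous_subtype_val.neg
    have hJ : J.OrdConnected := ⟨fun a ha c hc b hb =>
      hI.out hc ha ⟨neg_le_neg hb.2, neg_le_neg hb.1⟩⟩
    obtain ⟨l, hl, y, hU, h1, h2⟩ := ricceri_aux_s4 τ τ₁ hweak J hJ (fun x l => f x (-l))
      (fun x => (d1closed x).preimage hgc)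
      (fun x => by
        obtain ⟨m, hm, h⟩ := hne' x
        exact ⟨-m, by simpa [J] using hm, by simpa using h⟩)
      (fun x a ha c hc b hab hbc hfa hfc =>
        hconn x (-c) hc (-a) ha (-b) (neg_le_neg hbc) (neg_le_neg hab) hfc hfa)
      (fun x => (d1open x).preimage hgc)
      (fun l hl => d2 (-l) hl) (-l₀) (by simpa [J] using hl₀)
      (by simpa using d3comp)
      ⟨x, by simpa using hx, -m, by simpa [J] using hmI, neg_lt_neg h, by simpa using hm⟩
    exact ⟨-l, hl, y, hU, h1, by simpa using h2⟩
end

section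
/- Let X be a compact metric space, I ⊆ ℝ an interval, and f : X × I → ℝ a continuous function such that: (a₁) for every x ∈ X, the function λ ↦ f(x, λ) is concave on I; (a₂) for every λ ∈ I, each local minimum of the function x ↦ f(x, λ) is a global minimum. Then sup_{λ ∈ I} inf_{x ∈ X} f(x, λ) = inf_{x ∈ X} sup_{λ ∈ I} f(x, λ). -/
/-- **Theorem A (Borenshtein–Shul'man).** Let `X` be a compact metric space, `I` a real
interval, and `f : X × I → ℝ` a continuous function such that:
(a₁) for every `x ∈ X`, `f(x, ·)` is concave on `I`;
(a₂) for every `λ ∈ I`, each local minimum of `f(·, λ)` is a global minimum.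
Then `sup_{λ∈I} inf_{x∈X} f(x,λ) = inf_{x∈X} sup_{λ∈I} f(x,λ)`. -/
theorem borenshtein_shulman_minimax {X : Type*} [MetricSpace X] [CompactSpace X]
    (I : Set ℝ) (hI : I.Nonempty)
    (f : X → ℝ → ℝ)
    (hcont : ContinuousOn (Function.uncurry f) (Set.univ ×ˢ I))
    (a1 : ∀ x : X, ConcaveOn ℝ I (f x))
    (a2 : ∀ l ∈ I, ∀ x : X, (∃ U ∈ nhds x, ∀ y ∈ U, f x l ≤ f y l) →
      ∀ y : X, f x l ≤ f y l) :
    (⨆ l : I, ⨅ x : X, (f x l : EReal)) = ⨅ x : X, ⨆ l : I, (f x l : EReal) := by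
  classical
  apply le_antisymm (iSup_iInf_le_iInf_iSup _)
  by_contra hcon
  rw [not_le] at hcon
  obtain ⟨r, hr1, hr2⟩ := EReal.lt_iff_exists_real_btwn.1 hcon
  have h1 : ∀ l ∈ I, ∃ x, f x l < r := by
    intro l hl
    have h : (⨅ x : X, (f x l : EReal)) < r :=
      lt_of_le_of_lt (le_iSup (fun l : I => ⨅ x : X, (f x l : EReal)) ⟨l, hl⟩) hr1
    obtain ⟨x, hx⟩ := iInf_lt_iff.1 h
    exact ⟨x, EReal.coe_lt_coe_iff.1 hx⟩
  have h2 : ∀ x, ∃ l ∈ I, r < f x l := by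
    intro x
    have h : (r : EReal) < ⨆ l : I, (f x l : EReal) :=
      lt_of_lt_of_le hr2 (iInf_le (fun x : X => ⨆ l : I, (f x l : EReal)) x)
    obtain ⟨l, hl⟩ := lt_iSup_iff.1 h
    exact ⟨l, l.2, EReal.coe_lt_coe_iff.1 hl⟩
  obtain ⟨l0, hl0⟩ := hI
  obtain ⟨x0, hx0⟩ := h1 l0 hl0
  have hconv : Convex ℝ I := (a1 x0).1
  have hord : I.OrdConnected := hconv.ordConnected
  have hcx : ∀ l ∈ I, Continuous (fun x => f x l) := by
    intro l hl
    have : Continuous (Function.uncurry f ∘ fun x : X => (x, l)) :=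
      hcont.comp_continuous (by fun_prop) (by intro x; exact ⟨trivial, hl⟩)
    exact this
  -- finitely many parameters suffice
  obtain ⟨L, hL⟩ := isCompact_univ.elim_finite_subcover (fun l : I => {x : X | r < f x l})
    (fun l => isOpen_lt continuous_const (hcx l l.2))
    (by
      intro x _
      obtain ⟨l, hl, h⟩ := h2 x
      exact Set.mem_iUnion.2 ⟨⟨l, hl⟩, h⟩)
  have hL' : ∀ x, ∃ t ∈ L, r < f x t := by
    intro x
    have := hL (Set.mem_univ x)
    simpa using this
  have hLne : L.Nonempty := by
    obtain ⟨t, ht, _⟩ := hL' x0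
    exact ⟨t, ht⟩
  set a := L.min' hLne with ha
  set b := L.max' hLne with hb
  have hab : a ≤ b := Finset.min'_le_max' L hLne
  have hJ : ∀ l ∈ Set.Icc (a : ℝ) b, l ∈ I := fun l hl => hord.out a.2 b.2 hl
  have hab' : (a : ℝ) ≤ b := hab
  have hF : Continuous (fun p : X × Set.Icc (a : ℝ) b => f p.1 p.2) := by
    have : Continuous (Function.uncurry f ∘ fun p : X × Set.Icc (a : ℝ) b => (p.1, (p.2 : ℝ))) :=
      hcont.comp_continuous (by fun_prop) (by intro p; exact ⟨trivial, hJ _ p.2.2⟩)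
    exact this
  let C : Set (X × Set.Icc (a : ℝ) b) :=
    {p | f p.1 p.2 ≤ r ∧ ∀ t ∈ L, (p.2 : ℝ) ≤ t ∨ f p.1 t ≤ r}
  have hCclosed : IsClosed C := by
    have hC : C = {p | f p.1 p.2 ≤ r} ∩ ⋂ t ∈ L,
        ({p : X × Set.Icc (a : ℝ) b | (p.2 : ℝ) ≤ t} ∪ {p | f p.1 t ≤ r}) := by
      ext p
      simp [C]
    rw [hC]
    refine (isClosed_le hF continuous_const).inter ?_
    refine isClosed_biInter fun t _ => ?_
    exact (isClosed_le (by fun_prop) continuous_const).union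
      (isClosed_le ((hcx t t.2).comp continuous_fst) continuous_const)
  have hCex : ∀ p ∈ C, ∃ t ∈ L, (p.2 : ℝ) < t ∧ r < f p.1 t := by
    rintro ⟨x, l⟩ ⟨hp1, hp2⟩
    obtain ⟨t, ht, hrt⟩ := hL' x
    refine ⟨t, ht, lt_of_le_of_ne ?_ ?_, hrt⟩
    · rcases hp2 t ht with h | h
      · exact h
      · exact absurd hrt (not_lt.2 h)
    · intro h
      simp only at hp1 h hrt
      rw [h] at hp1
      exact absurd hrt (not_lt.2 hp1)
  have hCof : ∀ (x : X) (l : Set.Icc (a : ℝ) b) (t : I), f x l ≤ r → (l : ℝ) < t →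
      r < f x t → (x, l) ∈ C := by
    intro x l t hle hlt hrt
    refine ⟨hle, fun s hs => ?_⟩
    by_contra hcon
    push Not at hcon
    obtain ⟨hs1, hs2⟩ := hcon
    have := (a1 x).min_le_of_mem_Icc s.2 t.2 (z := (l : ℝ)) ⟨hs1.le, hlt.le⟩
    exact absurd (lt_of_lt_of_le (lt_min hs2 hrt) this) (not_lt.2 hle)
  let T : Set (Set.Icc (a : ℝ) b) := Prod.snd '' C
  have hTc : IsClosed T := isClosedMap_snd_of_compactSpace _ hCclosed
  have hTo : IsOpen T := by
    rw [isOpen_iff_mem_nhds]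
    rintro l ⟨⟨x1, l'⟩, hx1, rfl⟩
    change T ∈ nhds l'
    have hlI := hJ l' l'.2
    have hK : IsCompact {x : X | (x, l') ∈ C} :=
      (hCclosed.preimage (by fun_prop : Continuous fun x : X => (x, l'))).isCompact
    obtain ⟨x, hxC, hmin⟩ := hK.exists_isMinOn ⟨x1, hx1⟩ (hcx l' hlI).continuousOn
    obtain ⟨t, ht, hlt, hrt⟩ := hCex _ hxC
    have hglob := a2 l' hlI x ⟨{y | r < f y t},
      (isOpen_lt continuous_const (hcx t t.2)).mem_nhds hrt, by
        intro y hy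
        rcases le_or_gt (f y l') r with h | h
        · exact hmin (hCof y l' t h hlt hy)
        · exact hxC.1.trans h.le⟩
    obtain ⟨y, hy⟩ := h1 l' hlI
    have hxr : f x l' < r := lt_of_le_of_lt (hglob y) hy
    have hcl : Continuous (fun m : Set.Icc (a : ℝ) b => f x m) :=
      hF.comp (by fun_prop : Continuous fun m : Set.Icc (a : ℝ) b => (x, m))
    have e1 := (isOpen_lt hcl continuous_const).mem_nhds hxr
    have e2 := (isOpen_lt (continuous_subtype_val : Continuous
      fun m : Set.Icc (a : ℝ) b => (m : ℝ)) continuous_const).mem_nhds hlt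
    filter_upwards [e1, e2] with m hm1 hm2
    exact ⟨(x, m), hCof x m t (le_of_lt hm1) hm2 hrt, rfl⟩
  have hTne : T.Nonempty := by
    obtain ⟨x, hx⟩ := h1 a a.2
    refine ⟨⟨a, le_rfl, hab'⟩, (x, ⟨a, le_rfl, hab'⟩), ⟨hx.le, fun t ht => Or.inl ?_⟩, rfl⟩
    exact Finset.min'_le L t ht
  haveI : PreconnectedSpace (Set.Icc (a : ℝ) b) :=
    Subtype.preconnectedSpace isPreconnected_Icc
  have hTu : T = Set.univ := IsClopen.eq_univ ⟨hTc, hTo⟩ hTne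
  have hbT : (⟨b, hab', le_rfl⟩ : Set.Icc (a : ℝ) b) ∈ T := hTu ▸ Set.mem_univ _
  obtain ⟨p, hp, hpb⟩ := hbT
  obtain ⟨t, ht, hlt, _⟩ := hCex p hp
  rw [hpb] at hlt
  have : (t : ℝ) ≤ b := Finset.le_max' L t ht
  exact absurd hlt (not_lt.2 this)
end

section
/- Let X be a compact metric space, I ⊆ ℝ an interval, and f : X × I → ℝ a function such that: (b₁) for every x ∈ X, the function λ ↦ f(x, λ) is concave and continuous on I; (b₂) for every λ ∈ I, the function x ↦ f(x, λ) is lower semicontinuous and each of its local minima is a global minimum. Then sup_{λ ∈ I} inf_{x ∈ X} f(x, λ) = inf_{x ∈ X} sup_{λ ∈ I} f(x, λ). -/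
/-- **Theorem B (Saint Raymond).** Let `X` be a compact metric space, `I` a real interval,
and `f : X × I → ℝ` a function such that:
(b₁) for every `x ∈ X`, `f(x, ·)` is concave and continuous on `I`;
(b₂) for every `λ ∈ I`, `f(·, λ)` is lower semicontinuous and each of its local minima is
a global minimum.
Then `sup_{λ∈I} inf_{x∈X} f(x,λ) = inf_{x∈X} sup_{λ∈I} f(x,λ)`. -/
theorem saint_raymond_minimax {X : Type*} [MetricSpace X] [CompactSpace X]
    (I : Set ℝ) (hI : I.Nonempty)
    (f : X → ℝ → ℝ)
    (b1 : ∀ x : X, ConcaveOn ℝ I (f x) ∧ ContinuousOn (f x) I)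
    (b2lsc : ∀ l ∈ I, ∀ r : ℝ, IsClosed {x : X | f x l ≤ r})
    (b2min : ∀ l ∈ I, ∀ x : X, (∃ U ∈ nhds x, ∀ y ∈ U, f x l ≤ f y l) →
      ∀ y : X, f x l ≤ f y l) :
    (⨆ l : I, ⨅ x : X, (f x l : EReal)) = ⨅ x : X, ⨆ l : I, (f x l : EReal) := by
  refine le_antisymm (iSup_iInf_le_iInf_iSup _) ?_
  by_contra hlt
  rw [not_le] at hlt
  obtain ⟨r, h1, h2⟩ := EReal.lt_iff_exists_real_btwn.1 hlt
  have hlow : ∀ l ∈ I, ∃ x, f x l < r := by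
    intro l hl
    have h3 : (⨅ x : X, (f x l : EReal)) < r :=
      lt_of_le_of_lt (le_iSup (fun l : I => ⨅ x : X, (f x l : EReal)) ⟨l, hl⟩) h1
    obtain ⟨x, hx⟩ := iInf_lt_iff.1 h3
    exact ⟨x, by exact_mod_cast hx⟩
  have hhigh : ∀ x, ∃ l ∈ I, r < f x l := by
    intro x
    have h3 : (r : EReal) < ⨆ l : I, (f x l : EReal) :=
      lt_of_lt_of_le h2 (iInf_le (fun x : X => ⨆ l : I, (f x l : EReal)) x)
    obtain ⟨l, hx⟩ := lt_iSup_iff.1 h3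
    exact ⟨l, l.2, by exact_mod_cast hx⟩
  obtain ⟨l0, hl0⟩ := hI
  obtain ⟨x00, -⟩ := hlow l0 hl0
  -- finitely many parameters suffice
  obtain ⟨t, ht⟩ : ∃ t : Finset I, ∀ x, ∃ l ∈ t, r < f x l := by
    have := isCompact_univ.elim_finite_subfamily_closed
      (fun l : I => {x : X | f x l ≤ r}) (fun l => b2lsc l l.2 r) (by
        ext x
        obtain ⟨l, hl, hx⟩ := hhigh x
        simp only [Set.univ_inter, Set.mem_iInter, Set.mem_setOf_eq, Set.mem_empty_iff_false,
          iff_false, not_forall, not_le]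
        exact ⟨⟨l, hl⟩, hx⟩)
    obtain ⟨t, ht⟩ := this
    refine ⟨t, fun x => ?_⟩
    by_contra hcon
    push Not at hcon
    have : x ∈ (Set.univ ∩ ⋂ i ∈ t, {x : X | f x i ≤ r}) := by
      simp only [Set.univ_inter, Set.mem_iInter, Set.mem_setOf_eq]
      exact hcon
    rw [ht] at this
    exact this
  have htne : t.Nonempty := by
    obtain ⟨l, hl, -⟩ := ht x00
    exact ⟨l, hl⟩
  obtain ⟨a, haI, b, hbI, hJ⟩ : ∃ a ∈ I, ∃ b ∈ I, ∀ x, ∃ l ∈ Set.Icc a b, r < f x l := by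
    refine ⟨(t.min' htne : I), (t.min' htne).2, (t.max' htne : I), (t.max' htne).2, fun x => ?_⟩
    obtain ⟨l, hl, hx⟩ := ht x
    exact ⟨l, ⟨t.min'_le l hl, t.le_max' l hl⟩, hx⟩
  have hab : a ≤ b := by
    obtain ⟨l, hl, -⟩ := hJ x00
    exact hl.1.trans hl.2
  have hsub : Set.Icc a b ⊆ I := (b1 x00).1.1.ordConnected.out haI hbI
  let A : ℝ → Set X := fun l => {x | ∀ m ∈ Set.Icc a l, f x m ≤ r}
  let B : ℝ → Set X := fun l => {x | ∀ m ∈ Set.Icc l b, f x m ≤ r}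
  have hAcl : ∀ l ∈ Set.Icc a b, IsClosed (A l) := by
    intro l hl
    have : A l = ⋂ m ∈ Set.Icc a l, {x | f x m ≤ r} := by ext; simp [A]
    rw [this]
    exact isClosed_biInter fun m hm => b2lsc m (hsub ⟨hm.1, hm.2.trans hl.2⟩) r
  have hBcl : ∀ l ∈ Set.Icc a b, IsClosed (B l) := by
    intro l hl
    have : B l = ⋂ m ∈ Set.Icc l b, {x | f x m ≤ r} := by ext; simp [B]
    rw [this]
    exact isClosed_biInter fun m hm => b2lsc m (hsub ⟨hl.1.trans hm.1, hm.2⟩) r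
  have hAB : ∀ l ∈ Set.Icc a b, ∀ x ∈ A l, x ∉ B l := by
    intro l hl x hA hB
    obtain ⟨m, hm, hx⟩ := hJ x
    rcases le_total m l with h | h
    · exact absurd (hA m ⟨hm.1, h⟩) (not_le.2 hx)
    · exact absurd (hB m ⟨h, hm.2⟩) (not_le.2 hx)
  have hor : ∀ l ∈ Set.Icc a b, ∀ x, f x l ≤ r → x ∈ A l ∨ x ∈ B l := by
    intro l hl x hx
    by_contra hcon
    simp only [A, B, Set.mem_setOf_eq] at hcon
    push Not at hcon
    obtain ⟨⟨m, hm, hmr⟩, n, hn, hnr⟩ := hcon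
    have hmin := (b1 x).1.min_le_of_mem_Icc (hsub ⟨hm.1, hm.2.trans hl.2⟩)
      (hsub ⟨hl.1.trans hn.1, hn.2⟩) (show l ∈ Set.Icc m n from ⟨hm.2, hn.1⟩)
    have := lt_min hmr hnr
    linarith
  -- minimum on a nonempty `A l` lies strictly below `r`
  have hkey : ∀ l ∈ Set.Icc a b, (A l).Nonempty → ∃ x ∈ A l, f x l < r := by
    intro l hl hne
    have hlsc : LowerSemicontinuousOn (fun x => f x l) (A l) :=
      (lowerSemicontinuous_iff_isClosed_preimage.2 (b2lsc l (hsub hl))).lowerSemicontinuousOn _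
    obtain ⟨x, hxA, hx⟩ := hlsc.exists_isMinOn hne (hAcl l hl).isCompact
    refine ⟨x, hxA, ?_⟩
    have hglob := b2min l (hsub hl) x ⟨(B l)ᶜ, (hBcl l hl).isOpen_compl.mem_nhds (hAB l hl x hxA), by
      intro y hy
      by_cases hyr : f y l ≤ r
      · rcases hor l hl y hyr with h | h
        · exact hx h
        · exact absurd h hy
      · exact (hxA l ⟨hl.1, le_rfl⟩).trans (le_of_lt (not_le.1 hyr))⟩
    obtain ⟨y, hy⟩ := hlow l (hsub hl)
    exact (hglob y).trans_lt hy
  let S : Set ℝ := {l | l ∈ Set.Icc a b ∧ (A l).Nonempty}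
  have haS : a ∈ S := by
    obtain ⟨x, hx⟩ := hlow a haI
    refine ⟨⟨le_rfl, hab⟩, x, ?_⟩
    rintro m ⟨hm1, hm2⟩
    rw [le_antisymm hm2 hm1]
    exact hx.le
  have hSb : BddAbove S := ⟨b, fun l hl => hl.1.2⟩
  have hanti : ∀ l m, l ≤ m → A m ⊆ A l := fun l m h x hx n hn => hx n ⟨hn.1, hn.2.trans h⟩
  obtain ⟨x, hx⟩ : (⋂ l : S, A l).Nonempty := by
    haveI : Nonempty S := ⟨⟨a, haS⟩⟩
    refine IsCompact.nonempty_iInter_of_directed_nonempty_isCompact_isClosed _ ?_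
      (fun l => l.2.2) (fun l => (hAcl l l.2.1).isCompact) (fun l => hAcl l l.2.1)
    intro l m
    rcases le_total l m with h | h
    · exact ⟨m, hanti _ _ h, subset_rfl⟩
    · exact ⟨l, subset_rfl, hanti _ _ h⟩
  rw [Set.mem_iInter] at hx
  set c := sSup S with hc
  have hcI : c ∈ Set.Icc a b := ⟨le_csSup hSb haS, csSup_le ⟨a, haS⟩ fun l hl => hl.1.2⟩
  have hcont : ∀ x, ContinuousOn (f x) (Set.Icc a b) := fun x => (b1 x).2.mono hsub
  have hxc : x ∈ A c := by
    intro m hm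
    rcases hm.2.lt_or_eq with h | h
    · obtain ⟨l, hl, hml⟩ := exists_lt_of_lt_csSup ⟨a, haS⟩ h
      exact hx ⟨l, hl⟩ m ⟨hm.1, hml.le⟩
    · rw [h]
      have hcl : IsClosed (Set.Icc a b ∩ f x ⁻¹' Set.Iic r) :=
        (hcont x).preimage_isClosed_of_isClosed isClosed_Icc isClosed_Iic
      have hS : S ⊆ Set.Icc a b ∩ f x ⁻¹' Set.Iic r :=
        fun l hl => ⟨hl.1, hx ⟨l, hl⟩ l ⟨hl.1.1, le_rfl⟩⟩
      exact (closure_minimal hS hcl (csSup_mem_closure ⟨a, haS⟩ hSb)).2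
  obtain ⟨z, hzA, hz⟩ := hkey c hcI ⟨x, hxc⟩
  have hcb : c < b := by
    refine lt_of_le_of_ne hcI.2 fun h => ?_
    obtain ⟨l, hl, hlr⟩ := hJ z
    exact absurd (hzA l ⟨hl.1, h ▸ hl.2⟩) (not_le.2 hlr)
  have hev := (hcont z c hcI).eventually (gt_mem_nhds hz)
  rw [Filter.Eventually, Metric.mem_nhdsWithin_iff] at hev
  obtain ⟨ε, hε, hball⟩ := hev
  have hd : min (c + ε / 2) b ∈ S := by
    refine ⟨⟨le_min (by linarith [hcI.1]) hab, min_le_right _ _⟩, z, ?_⟩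
    intro m hm
    rcases le_total m c with h | h
    · exact hzA m ⟨hm.1, h⟩
    · have h5 : m ≤ c + ε / 2 := hm.2.trans (min_le_left _ _)
      have h6 : m ≤ b := hm.2.trans (min_le_right _ _)
      refine le_of_lt (hball ⟨?_, hm.1, h6⟩)
      rw [Metric.mem_ball, Real.dist_eq, abs_of_nonneg (by linarith)]
      linarith
  have h7 : min (c + ε / 2) b ≤ c := le_csSup hSb hd
  have h8 : c < min (c + ε / 2) b := lt_min (by linarith) hcb
  linarith
end
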